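/- Let (A,∘,α) be a multiplicative Hom-Jordan superalgebra. Define ⟨x,y,z⟩ := (x∘y)∘α(z) + α(x)∘(y∘z) - (-1)^{|x||y|} α(y)∘(x∘z). Then (A, ⟨·,·,·⟩, α²) is a multiplicative Hom-Jordan supertriple system. -/

import Mathlib

def sgn (K : Type*) [Field K] (i j : ZMod 2) : K := (-1 : K) ^ (i * j).val

def IsBilin (K : Type*) {A : Type*} [Field K] [AddCommGroup A] [Module K A]
    (f : A → A → A) : Prop :=
  (∀ (c : K) (x y : A), f (c • x) y = c • f x y) ∧
  (∀ x x' y : A, f (x + x') y = f x y + f x' y) ∧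
  (∀ (c : K) (x y : A), f x (c • y) = c • f x y) ∧
  (∀ x y y' : A, f x (y + y') = f x y + f x y')

def IsTrilin (K : Type*) {A : Type*} [Field K] [AddCommGroup A] [Module K A]
    (f : A → A → A → A) : Prop :=
  (∀ (c : K) (x y z : A), f (c • x) y z = c • f x y z) ∧
  (∀ x x' y z : A, f (x + x') y z = f x y z + f x' y z) ∧
  (∀ (c : K) (x y z : A), f x (c • y) z = c • f x y z) ∧
  (∀ x y y' z : A, f x (y + y') z = f x y z + f x y' z) ∧
  (∀ (c : K) (x y z : A), f x y (c • z) = c • f x y z) ∧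
  (∀ x y z z' : A, f x y (z + z') = f x y z + f x y z')

def asc {A : Type*} [AddCommGroup A] (mul : A → A → A) (x y z : A) : A :=
  mul (mul x y) z - mul x (mul y z)

def hasc {A : Type*} [AddCommGroup A] (mul : A → A → A) (α : A → A) (x y z : A) : A :=
  mul (mul x y) (α z) - mul (α x) (mul y z)

def br (K : Type*) {A : Type*} [Field K] [AddCommGroup A] [Module K A]
    (mul : A → A → A) (i j : ZMod 2) (x y : A) : A :=
  (2 : K)⁻¹ • (mul x y - sgn K i j • mul y x)

def jp (K : Type*) {A : Type*} [Field K] [AddCommGroup A] [Module K A]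
    (mul : A → A → A) (i j : ZMod 2) (x y : A) : A :=
  (2 : K)⁻¹ • (mul x y + sgn K i j • mul y x)

/-- The triple product `⟨x,y,z⟩ = (x∘y)∘α(z) + α(x)∘(y∘z) - (-1)^{|x||y|} α(y)∘(x∘z)`
on a Hom-Jordan superalgebra, for `x,y` homogeneous of degrees `i,j`. -/
def hT (K : Type*) {A : Type*} [Field K] [AddCommGroup A] [Module K A]
    (mul : A → A → A) (α : A → A) (i j : ZMod 2) (x y z : A) : A :=
  mul (mul x y) (α z) + mul (α x) (mul y z) - sgn K i j • mul (α y) (mul x z)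

/-- The laws of a multiplicative Hom-Jordan superalgebra, on homogeneous elements. -/
structure IsHomJordanSuper (K : Type*) {A : Type*} [Field K] [AddCommGroup A] [Module K A]
    (𝒜 : ZMod 2 → Submodule K A) (mul : A → A → A) (α : A → A) : Prop where
  bilin : IsBilin K mul
  mul_mem : ∀ (i j : ZMod 2) (x y : A), x ∈ 𝒜 i → y ∈ 𝒜 j → mul x y ∈ 𝒜 (i + j)
  map_smul : ∀ (c : K) (x : A), α (c • x) = c • α x
  map_add : ∀ x y : A, α (x + y) = α x + α y
  map_mem : ∀ (i : ZMod 2) (x : A), x ∈ 𝒜 i → α x ∈ 𝒜 i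
  map_mul : ∀ x y : A, α (mul x y) = mul (α x) (α y)
  comm : ∀ (i j : ZMod 2) (x y : A), x ∈ 𝒜 i → y ∈ 𝒜 j → mul x y = sgn K i j • mul y x
  jordan : ∀ (i j k l : ZMod 2) (x y z t : A), x ∈ 𝒜 i → y ∈ 𝒜 j → z ∈ 𝒜 k → t ∈ 𝒜 l →
    sgn K l (i + k) • hasc mul α (mul x y) (α z) (α t)
      + sgn K i (j + k) • hasc mul α (mul y t) (α z) (α x)
      + sgn K j (l + k) • hasc mul α (mul t x) (α z) (α y) = 0

section Sign

variable (K : Type*) [Field K]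

theorem sgn_add_left (i j k : ZMod 2) : sgn K (i + j) k = sgn K i k * sgn K j k := by
  have key : ∀ i j k : ZMod 2,
      ((i + j) * k).val % 2 = ((i * k).val + (j * k).val) % 2 := by decide
  rw [sgn, sgn, sgn, ← pow_add, neg_one_pow_eq_pow_mod_two, key, ← neg_one_pow_eq_pow_mod_two]

theorem sgn_comm (i j : ZMod 2) : sgn K i j = sgn K j i := by
  simp only [sgn, mul_comm]

theorem sgn_add_right (i j k : ZMod 2) : sgn K i (j + k) = sgn K i j * sgn K i k := by
  rw [sgn_comm, sgn_add_left, sgn_comm K j, sgn_comm K k]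

theorem sgn_mul_self (i j : ZMod 2) : sgn K i j * sgn K i j = 1 := by
  rw [sgn, ← pow_add, Even.neg_one_pow ⟨_, rfl⟩]

end Sign

/-- The operator `α(x)∘(y∘z) - (-1)^{|x||y|} α(y)∘(x∘z)`, the twisted supercommutator of
left multiplications. -/
def hD (K : Type*) {A : Type*} [Field K] [AddCommGroup A] [Module K A]
    (mul : A → A → A) (α : A → A) (i j : ZMod 2) (x y z : A) : A :=
  mul (α x) (mul y z) - sgn K i j • mul (α y) (mul x z)

namespace IsHomJordanSuper

variable {K A : Type*} [Field K] [AddCommGroup A] [Module K A] {𝒜 : ZMod 2 → Submodule K A}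
  {mul : A → A → A} {α : A → A}

section Linear

variable (h : IsHomJordanSuper K 𝒜 mul α)
include h

theorem smul_mul (c : K) (x y : A) : mul (c • x) y = c • mul x y := h.bilin.1 c x y

theorem add_mul (x x' y : A) : mul (x + x') y = mul x y + mul x' y := h.bilin.2.1 x x' y

theorem mul_smul (c : K) (x y : A) : mul x (c • y) = c • mul x y := h.bilin.2.2.1 c x y

theorem mul_add (x y y' : A) : mul x (y + y') = mul x y + mul x y' := h.bilin.2.2.2 x y y'

theorem sub_mul (x x' y : A) : mul (x - x') y = mul x y - mul x' y := by
  have := h.smul_mul (-1) x' y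
  rw [sub_eq_add_neg, h.add_mul, ← neg_one_smul K x', this, neg_one_smul, sub_eq_add_neg]

theorem mul_sub (x y y' : A) : mul x (y - y') = mul x y - mul x y' := by
  have := h.mul_smul (-1) x y'
  rw [sub_eq_add_neg, h.mul_add, ← neg_one_smul K y', this, neg_one_smul, sub_eq_add_neg]

theorem map_sub (x y : A) : α (x - y) = α x - α y := by
  have := h.map_smul (-1) y
  rw [sub_eq_add_neg, h.map_add, ← neg_one_smul K y, this, neg_one_smul, sub_eq_add_neg]

end Linear

/-- `hD` acts as a twisted superderivation of `mul`. -/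
theorem hD_mul (h : IsHomJordanSuper K 𝒜 mul α) {i j k l : ZMod 2} {x y z t : A}
    (hx : x ∈ 𝒜 i) (hy : y ∈ 𝒜 j) (hz : z ∈ 𝒜 k) (ht : t ∈ 𝒜 l) :
    hD K mul α i j (α x) (α y) (mul z t)
      = mul (hD K mul α i j x y z) (α (α t))
        + (sgn K i k * sgn K j k) • mul (α (α z)) (hD K mul α i j x y t) := by
  have J₁ := h.jordan _ _ _ _ _ _ _ _ hz hx hy ht
  have J₂ := h.jordan _ _ _ _ _ _ _ _ hz hy hx ht
  have mα {n : ZMod 2} {a : A} (ha : a ∈ 𝒜 n) := h.map_mem _ _ ha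
  have mm {n m : ZMod 2} {a b : A} (ha : a ∈ 𝒜 n) (hb : b ∈ 𝒜 m) := h.mul_mem _ _ _ _ ha hb
  have C {n m : ZMod 2} {a b : A} (ha : a ∈ 𝒜 n) (hb : b ∈ 𝒜 m) := h.comm _ _ _ _ ha hb
  simp only [hasc, h.map_mul, h.map_smul, C hz hx, C hz hy, C ht hz, h.smul_mul, h.mul_smul,
    C (mm hx hz) (mα hy), C (mm hy hz) (mα hx), C (mm hx ht) (mα hy), C (mm hy ht) (mα hx),
    C (mm hz ht) (mα hx), C (mm hz ht) (mα hy),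
    C (mm (mα hy) (mm hz ht)) (mα (mα hx)), C (mm (mα hx) (mm hz ht)) (mα (mα hy)),
    C (mm (mα hy) (mm hx ht)) (mα (mα hz)), C (mm (mα hx) (mm hy ht)) (mα (mα hz)),
    C (mα hy) (mα hx), C (mα hy) (mα hz), C (mα hx) (mα hz),
    C (mm (mα hy) (mα ht)) (mm (mα hz) (mα hx)),
    C (mm (mα hx) (mα ht)) (mm (mα hz) (mα hy)), sgn_add_left, sgn_add_right] at J₁ J₂
  simp only [hD, h.mul_sub, h.sub_mul, h.mul_smul, h.smul_mul]
  have e₁ := sgn_mul_self K i j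
  have e₂ := sgn_mul_self K i k
  have e₃ := sgn_mul_self K i l
  have e₄ := sgn_mul_self K j k
  have e₅ := sgn_mul_self K j l
  have e₆ := sgn_mul_self K k l
  simp only [sgn_comm K j i, sgn_comm K k i, sgn_comm K l i, sgn_comm K k j, sgn_comm K l j,
    sgn_comm K l k] at J₁ J₂ ⊢
  linear_combination (norm := (match_scalars <;> clear mα mm C J₁ J₂ <;> grind))
    (sgn K k l * sgn K j k * sgn K j l * sgn K i k) • J₁
    - (sgn K i j * sgn K k l * sgn K i k * sgn K i l * sgn K j k) • J₂

theorem hD_mul_left (h : IsHomJordanSuper K 𝒜 mul α) {k p q r : ZMod 2} {z u v t : A}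
    (hz : z ∈ 𝒜 k) (hu : u ∈ 𝒜 p) (hv : v ∈ 𝒜 q) (ht : t ∈ 𝒜 r) :
    hD K mul α k (p + q) (α z) (mul u v) (α t)
      = hD K mul α (k + p) q (mul z u) (α v) (α t)
        + sgn K p q • hD K mul α (k + q) p (mul z v) (α u) (α t) := by
  have J := h.jordan _ _ _ _ _ _ _ _ hz hu ht hv
  have mα {n : ZMod 2} {a : A} (ha : a ∈ 𝒜 n) := h.map_mem _ _ ha
  have mm {n m : ZMod 2} {a b : A} (ha : a ∈ 𝒜 n) (hb : b ∈ 𝒜 m) := h.mul_mem _ _ _ _ ha hb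
  have C {n m : ZMod 2} {a b : A} (ha : a ∈ 𝒜 n) (hb : b ∈ 𝒜 m) := h.comm _ _ _ _ ha hb
  simp only [hasc, h.map_mul, h.map_smul, C hv hz, h.smul_mul, h.mul_smul,
    C (mm (mm hz hu) (mα ht)) (mα (mα hv)), C (mm (mm hu hv) (mα ht)) (mα (mα hz)),
    C (mm (mm hz hv) (mα ht)) (mα (mα hu)), C (mα ht) (mα hz), C (mα ht) (mα hu),
    C (mα ht) (mα hv), sgn_add_left, sgn_add_right] at J
  simp only [hD, h.map_mul, sgn_add_left, sgn_add_right]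
  have e₁ := sgn_mul_self K k p
  have e₂ := sgn_mul_self K k q
  have e₃ := sgn_mul_self K k r
  have e₄ := sgn_mul_self K p q
  have e₅ := sgn_mul_self K p r
  have e₆ := sgn_mul_self K q r
  simp only [sgn_comm K p k, sgn_comm K q k, sgn_comm K r k, sgn_comm K q p, sgn_comm K r p,
    sgn_comm K r q] at J ⊢
  linear_combination (norm := (match_scalars <;> clear mα mm C J <;> grind))
    sgn K k q • J

theorem hT_outer_symm (h : IsHomJordanSuper K 𝒜 mul α) {i j k : ZMod 2} {x y z : A}
    (hx : x ∈ 𝒜 i) (hy : y ∈ 𝒜 j) (hz : z ∈ 𝒜 k) :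
    hT K mul α i j x y z
      = (sgn K i j * sgn K i k * sgn K j k) • hT K mul α k j z y x := by
  have mα {n : ZMod 2} {a : A} (ha : a ∈ 𝒜 n) := h.map_mem _ _ ha
  have mm {n m : ZMod 2} {a b : A} (ha : a ∈ 𝒜 n) (hb : b ∈ 𝒜 m) := h.mul_mem _ _ _ _ ha hb
  have C {n m : ZMod 2} {a b : A} (ha : a ∈ 𝒜 n) (hb : b ∈ 𝒜 m) := h.comm _ _ _ _ ha hb
  simp only [hT, C hz hy, C hy hx, C hz hx, h.smul_mul, h.mul_smul, C (mm hx hy) (mα hz),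
    C (mm hy hz) (mα hx), sgn_add_left]
  have e₁ := sgn_mul_self K i j
  have e₂ := sgn_mul_self K i k
  have e₃ := sgn_mul_self K j k
  simp only [sgn_comm K j i, sgn_comm K k i, sgn_comm K k j]
  match_scalars <;> clear mα mm C <;> grind

theorem hT_mem (h : IsHomJordanSuper K 𝒜 mul α) {i j k : ZMod 2} {x y z : A}
    (hx : x ∈ 𝒜 i) (hy : y ∈ 𝒜 j) (hz : z ∈ 𝒜 k) :
    hT K mul α i j x y z ∈ 𝒜 (i + j + k) := by
  have mα {n : ZMod 2} {a : A} (ha : a ∈ 𝒜 n) := h.map_mem _ _ ha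
  have mm {n m : ZMod 2} {a b : A} (ha : a ∈ 𝒜 n) (hb : b ∈ 𝒜 m) := h.mul_mem _ _ _ _ ha hb
  refine sub_mem (add_mem (mm (mm hx hy) (mα hz)) ?_) (Submodule.smul_mem _ _ ?_)
  · simpa only [add_assoc] using mm (mα hx) (mm hy hz)
  · simpa only [add_assoc, add_left_comm] using mm (mα hy) (mm hx hz)

theorem map_map_hT (h : IsHomJordanSuper K 𝒜 mul α) (i j : ZMod 2) (x y z : A) :
    α (α (hT K mul α i j x y z)) = hT K mul α i j (α (α x)) (α (α y)) (α (α z)) := by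
  simp only [hT, h.map_sub, h.map_add, h.map_smul, h.map_mul]

theorem hT_hT (h : IsHomJordanSuper K 𝒜 mul α) {i j p q r : ZMod 2} {x y u v w : A}
    (hx : x ∈ 𝒜 i) (hy : y ∈ 𝒜 j) (hu : u ∈ 𝒜 p) (hv : v ∈ 𝒜 q) (hw : w ∈ 𝒜 r) :
    hT K mul α i j (α (α x)) (α (α y)) (hT K mul α p q u v w)
        - hT K mul α (i + j + p) q (hT K mul α i j x y u) (α (α v)) (α (α w))
      = sgn K (i + j) (p + q) •
          (hT K mul α p q (α (α u)) (α (α v)) (hT K mul α i j x y w)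
            - hT K mul α p (q + i + j) (α (α u)) (hT K mul α q i v x y) (α (α w))) := by
  have mα {n : ZMod 2} {a : A} (ha : a ∈ 𝒜 n) := h.map_mem _ _ ha
  have mm {n m : ZMod 2} {a b : A} (ha : a ∈ 𝒜 n) (hb : b ∈ 𝒜 m) := h.mul_mem _ _ _ _ ha hb
  have C {n m : ZMod 2} {a b : A} (ha : a ∈ 𝒜 n) (hb : b ∈ 𝒜 m) := h.comm _ _ _ _ ha hb
  have I₁ := h.hD_mul (mα hx) (mα hy) (mα hu) (mm hv hw)
  rw [h.hD_mul hx hy hv hw] at I₁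
  have I₂ := h.hD_mul (mα hx) (mα hy) (mα hv) (mm hu hw)
  rw [h.hD_mul hx hy hu hw] at I₂
  have I₃ := h.hD_mul (mα hx) (mα hy) (mm hu hv) (mα hw)
  rw [h.hD_mul hx hy hu hv] at I₃
  have I₄ := h.hD_mul (mα hu) (mα hv) (mm hx hy) (mα hw)
  have I₅ := h.hD_mul_left (mm hx hy) (mα hu) (mα hv) (mα hw)
  simp only [hD, h.map_mul, h.mul_add, h.mul_sub, h.add_mul,
    h.sub_mul, h.mul_smul, h.smul_mul, sgn_add_left, sgn_add_right, C (mα hv) (mm hx hy),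
    C (mα hu) (mm hx hy), C (mα (mα hv)) (mm (mm hx hy) (mα hu))] at I₁ I₂ I₃ I₄ I₅
  simp only [hT, h.map_mul, h.map_smul, h.map_add, h.map_sub, h.mul_add, h.mul_sub, h.add_mul,
    h.sub_mul, h.mul_smul, h.smul_mul, sgn_add_left, sgn_add_right, C hv hx, C hv hy,
    C (mm hx hv) (mα hy), C (mα hv) (mm hx hy)]
  have e₁ := sgn_mul_self K i p
  have e₂ := sgn_mul_self K i q
  have e₃ := sgn_mul_self K j p
  have e₄ := sgn_mul_self K j q
  have e₅ := sgn_mul_self K p q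
  simp only [sgn_comm K p i, sgn_comm K q i, sgn_comm K p j, sgn_comm K q j, sgn_comm K q p]
    at I₁ I₂ I₃ I₄ I₅ ⊢
  linear_combination (norm := (match_scalars <;> clear mα mm C I₁ I₂ I₃ I₄ I₅ <;> grind))
    I₁ - sgn K p q • I₂ + I₃
      - (sgn K i p * sgn K i q * sgn K j p * sgn K j q) • I₄ + I₅

end IsHomJordanSuper

/-- Theorem 7.1: a multiplicative Hom-Jordan superalgebra gives a multiplicative
Hom-Jordan supertriple system with twisting map α². -/
theorem stmt13 {K A : Type*} [Field K] [AddCommGroup A] [Module K A]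
    (h2 : (2 : K) ≠ 0) (h3 : (3 : K) ≠ 0)
    (𝒜 : ZMod 2 → Submodule K A) (hds : DirectSum.IsInternal 𝒜)
    (mul : A → A → A) (hbil : IsBilin K mul)
    (hgr : ∀ (i j : ZMod 2) (x y : A), x ∈ 𝒜 i → y ∈ 𝒜 j → mul x y ∈ 𝒜 (i + j))
    (α : A → A)
    (hαsmul : ∀ (c : K) (x : A), α (c • x) = c • α x)
    (hαadd : ∀ x y : A, α (x + y) = α x + α y)
    (hαeven : ∀ (i : ZMod 2) (x : A), x ∈ 𝒜 i → α x ∈ 𝒜 i)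
    (hαmul : ∀ x y : A, α (mul x y) = mul (α x) (α y))
    (hcomm : ∀ (i j : ZMod 2) (x y : A), x ∈ 𝒜 i → y ∈ 𝒜 j →
      mul x y = sgn K i j • mul y x)
    (hjordan : ∀ (i j k l : ZMod 2) (x y z t : A),
      x ∈ 𝒜 i → y ∈ 𝒜 j → z ∈ 𝒜 k → t ∈ 𝒜 l →
      sgn K l (i + k) • hasc mul α (mul x y) (α z) (α t)
        + sgn K i (j + k) • hasc mul α (mul y t) (α z) (α x)
        + sgn K j (l + k) • hasc mul α (mul t x) (α z) (α y) = 0)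
    :
    -- grading
    (∀ (i j k : ZMod 2) (x y z : A), x ∈ 𝒜 i → y ∈ 𝒜 j → z ∈ 𝒜 k →
      hT K mul α i j x y z ∈ 𝒜 (i + j + k)) ∧
    -- multiplicativity of α²
    (∀ (i j : ZMod 2) (x y z : A),
      α (α (hT K mul α i j x y z)) = hT K mul α i j (α (α x)) (α (α y)) (α (α z))) ∧
    -- outer supersymmetry
    (∀ (i j k : ZMod 2) (x y z : A), x ∈ 𝒜 i → y ∈ 𝒜 j → z ∈ 𝒜 k →
      hT K mul α i j x y z
        = (sgn K i j * sgn K i k * sgn K j k) • hT K mul α k j z y x) ∧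
    -- Hom-Jordan supertriple identity with twist α²
    (∀ (i j p q r : ZMod 2) (x y u v w : A),
      x ∈ 𝒜 i → y ∈ 𝒜 j → u ∈ 𝒜 p → v ∈ 𝒜 q → w ∈ 𝒜 r →
      hT K mul α i j (α (α x)) (α (α y)) (hT K mul α p q u v w)
        - hT K mul α (i + j + p) q (hT K mul α i j x y u) (α (α v)) (α (α w))
      = sgn K (i + j) (p + q) •
          (hT K mul α p q (α (α u)) (α (α v)) (hT K mul α i j x y w)
            - hT K mul α p (q + i + j) (α (α u)) (hT K mul α q i v x y) (α (α w)))) := by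
  have h : IsHomJordanSuper K 𝒜 mul α :=
    ⟨hbil, hgr, hαsmul, hαadd, hαeven, hαmul, hcomm, hjordan⟩
  exact ⟨fun _ _ _ _ _ _ hx hy hz => h.hT_mem hx hy hz, h.map_map_hT,
    fun _ _ _ _ _ _ hx hy hz => h.hT_outer_symm hx hy hz,
    fun _ _ _ _ _ _ _ _ _ _ hx hy hu hv hw => h.hT_hT hx hy hu hv hw⟩
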